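/- arXiv:2302.13103 — 2 statements merged into one kernel-verified Lean document; each statement's English description precedes it below -/
import Mathlib

section
/- Let V, Y : W → ℝ be real-valued Γ-periodic potentials that are Floquet isospectral, and fix a partition of the coordinates 1,…,d into consecutive blocks of sizes d₁,…,d_r (r ≥ 2, d₁+⋯+d_r = d). Then for every j ∈ {1,…,r}, Σ |V̂(l)|² = Σ |Ŷ(l)|², where both sums run over all l ∈ W whose coordinates outside the j-th block are all zero. -/
open scoped BigOperators

noncomputable section

namespace DPSO

/-- The Floquet matrix `𝒟_V(z)` of the discrete periodic Schrödinger operator, indexed by the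
fundamental domain `W = ∏ i, ZMod (q i)`. -/
def floquetMat {d : ℕ} (q : Fin d → ℕ) [∀ i, NeZero (q i)]
    (V : (∀ i, ZMod (q i)) → ℂ) (z : Fin d → ℂ) :
    Matrix (∀ i, ZMod (q i)) (∀ i, ZMod (q i)) ℂ :=
  fun n n' =>
    (∑ j : Fin d,
      ((if n' = n + Pi.single j 1 then (if (n j).val = q j - 1 then z j else 1) else 0)
        + (if n' = n - Pi.single j 1 then (if (n j).val = 0 then (z j)⁻¹ else 1) else 0)))
    + (if n' = n then V n else 0)

/-- Two `Γ`-periodic potentials are Floquet isospectral if for every real quasimomentum `k`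
the Floquet matrices have the same characteristic polynomial. -/
def FloquetIso {d : ℕ} (q : Fin d → ℕ) [∀ i, NeZero (q i)]
    (V Y : (∀ i, ZMod (q i)) → ℂ) : Prop :=
  ∀ k : Fin d → ℝ,
    (floquetMat q V (fun j => Complex.exp (2 * Real.pi * Complex.I * (k j)))).charpoly
      = (floquetMat q Y (fun j => Complex.exp (2 * Real.pi * Complex.I * (k j)))).charpoly

/-- Two `Γ`-periodic potentials are Fermi isospectral if for some `λ₀` their Fermi surfaces
(inside `(ℂ∖{0})^d`) coincide. -/
def FermiIso {d : ℕ} (q : Fin d → ℕ) [∀ i, NeZero (q i)]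
    (V Y : (∀ i, ZMod (q i)) → ℂ) : Prop :=
  ∃ lam : ℂ,
    {z : Fin d → ℂ | (∀ j, z j ≠ 0) ∧ (floquetMat q V z - lam • 1).det = 0}
      = {z : Fin d → ℂ | (∀ j, z j ≠ 0) ∧ (floquetMat q Y z - lam • 1).det = 0}

/-- The offset (start index) of the `j`-th consecutive block of sizes `ds 0, …, ds (r-1)`. -/
def blockOffset {r : ℕ} (ds : Fin r → ℕ) (j : Fin r) : ℕ :=
  ∑ m ∈ Finset.univ.filter (fun m => m < j), ds m

lemma blockOffset_add_le {r : ℕ} (ds : Fin r → ℕ) (j : Fin r) :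
    blockOffset ds j + ds j ≤ ∑ m, ds m := by
  have hj : j ∉ Finset.univ.filter (fun m : Fin r => m < j) := by simp
  have h : blockOffset ds j + ds j
      = ∑ m ∈ insert j (Finset.univ.filter (fun m : Fin r => m < j)), ds m := by
    rw [Finset.sum_insert hj, Nat.add_comm, blockOffset]
  rw [h]
  exact Finset.sum_le_sum_of_subset (Finset.subset_univ _)

/-- The embedding of the index set of the `j`-th block into `Fin d`. -/
def blockEmb {d r : ℕ} (ds : Fin r → ℕ) (hsum : ∑ m, ds m = d) (j : Fin r)
    (b : Fin (ds j)) : Fin d :=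
  ⟨blockOffset ds j + b.val, by
    have h1 := blockOffset_add_le ds j
    have h2 := b.isLt
    omega⟩

/-- `V` is `(d₁,…,d_r)` separable: it is a sum of functions, the `j`-th of which depends only
on the coordinates in the `j`-th block. -/
def IsSeparable {d r : ℕ} (q : Fin d → ℕ) (ds : Fin r → ℕ) (hsum : ∑ m, ds m = d)
    (V : (∀ i, ZMod (q i)) → ℂ) : Prop :=
  ∃ F : ∀ j : Fin r, ((∀ b : Fin (ds j), ZMod (q (blockEmb ds hsum j b))) → ℂ),
    ∀ n, V n = ∑ j, F j (fun b => n (blockEmb ds hsum j b))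

/-- The discrete Fourier transform of `V`. -/
def dft {d : ℕ} (q : Fin d → ℕ) [∀ i, NeZero (q i)] (V : (∀ i, ZMod (q i)) → ℂ)
    (l : ∀ i, ZMod (q i)) : ℂ :=
  (1 / ∏ i, (q i : ℂ)) * ∑ n : ∀ i, ZMod (q i), V n *
    Complex.exp (-(2 * Real.pi * Complex.I) *
      ∑ j, ((l j).val : ℂ) * ((n j).val : ℂ) / (q j : ℂ))

/-- `ρ^j_m = e^{2πi m/q_j}`. -/
def rho {d : ℕ} (q : Fin d → ℕ) (j : Fin d) (m : ℕ) : ℂ :=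
  Complex.exp (2 * Real.pi * Complex.I * (m : ℂ) / (q j : ℂ))

/-- The average `[V]` of a potential. -/
def avg {d : ℕ} (q : Fin d → ℕ) [∀ i, NeZero (q i)] (V : (∀ i, ZMod (q i)) → ℂ) : ℂ :=
  (1 / ∏ i, (q i : ℂ)) * ∑ n, V n

/-- The diagonal matrix `A(z)`. -/
def diagA {d : ℕ} (q : Fin d → ℕ) [∀ i, NeZero (q i)] (z : Fin d → ℂ) :
    Matrix (∀ i, ZMod (q i)) (∀ i, ZMod (q i)) ℂ :=
  Matrix.diagonal (fun n => ∑ j, (rho q j ((n j).val) * z j + (rho q j ((n j).val) * z j)⁻¹))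

/-- The matrix `B_V` with entries `V̂(n - n')`. -/
def matB {d : ℕ} (q : Fin d → ℕ) [∀ i, NeZero (q i)] (V : (∀ i, ZMod (q i)) → ℂ) :
    Matrix (∀ i, ZMod (q i)) (∀ i, ZMod (q i)) ℂ :=
  fun n n' => dft q V (n - n')

section Fourier

variable {d : ℕ} (q : Fin d → ℕ) [∀ i, NeZero (q i)]

lemma rho_val (j : Fin d) (a : ZMod (q j)) : rho q j a.val = ZMod.stdAddChar a := by
  rw [rho, ZMod.stdAddChar_apply, ZMod.toCircle_apply]

/-- The pairing `χ_l(n) = exp (2πi ∑ j, l_j n_j / q_j)` on `W`. -/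
def pairing (l n : ∀ i, ZMod (q i)) : ℂ := ∏ j, ZMod.stdAddChar (l j * n j)

lemma pairing_add_left (l m n : ∀ i, ZMod (q i)) :
    pairing q (l + m) n = pairing q l n * pairing q m n := by
  simp [pairing, add_mul, AddChar.map_add_eq_mul, Finset.prod_mul_distrib]

lemma pairing_add_right (l m n : ∀ i, ZMod (q i)) :
    pairing q l (m + n) = pairing q l m * pairing q l n := by
  simp [pairing, mul_add, AddChar.map_add_eq_mul, Finset.prod_mul_distrib]

lemma pairing_neg_left (l n : ∀ i, ZMod (q i)) : pairing q (-l) n = pairing q l (-n) := by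
  simp [pairing]

lemma pairing_single (l : ∀ i, ZMod (q i)) (j : Fin d) :
    pairing q l (Pi.single j 1) = ZMod.stdAddChar (l j) := by
  rw [pairing, Finset.prod_eq_single j]
  · simp
  · intro b _ hb
    simp [Pi.single_eq_of_ne hb]
  · simp

/-- Orthogonality of the characters of `W`. -/
lemma sum_pairing (m : ∀ i, ZMod (q i)) :
    ∑ l, pairing q l m = if m = 0 then ∏ i, (q i : ℂ) else 0 := by
  have h : ∀ i, ∑ a : ZMod (q i), (ZMod.stdAddChar (a * m i) : ℂ)
      = if m i = 0 then (q i : ℂ) else 0 := fun i => by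
    rw [AddChar.sum_mulShift _ (ZMod.isPrimitive_stdAddChar _), ZMod.card]
    push_cast
    rfl
  have h' := Finset.prod_univ_sum (fun i : Fin d => (Finset.univ : Finset (ZMod (q i))))
    (fun i a => (ZMod.stdAddChar (a * m i) : ℂ))
  simp only [Fintype.piFinset_univ, h] at h'
  unfold pairing
  rw [← h']
  split_ifs with hm
  · simp [hm]
  · obtain ⟨i, hi⟩ := Function.ne_iff.mp hm
    exact Finset.prod_eq_zero (Finset.mem_univ i) (if_neg hi)

lemma prod_natCast_ne_zero : ∏ i, (q i : ℂ) ≠ 0 :=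
  Finset.prod_ne_zero_iff.mpr fun i _ => Nat.cast_ne_zero.mpr (NeZero.ne (q i))

lemma dft_eq (V : (∀ i, ZMod (q i)) → ℂ) (l : ∀ i, ZMod (q i)) :
    dft q V l = (∏ i, (q i : ℂ))⁻¹ * ∑ n, V n * pairing q l (-n) := by
  rw [dft, one_div]
  congr 1
  refine Finset.sum_congr rfl fun n _ => ?_
  rw [pairing, Finset.mul_sum, Complex.exp_sum]
  congr 1
  refine Finset.prod_congr rfl fun j _ => ?_
  have h : l j * (-n) j = ((-((l j).val * (n j).val : ℤ) : ℤ) : ZMod (q j)) := by simp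
  rw [h, ZMod.stdAddChar_coe]
  congr 1
  push_cast
  ring

lemma sum_dft_mul_pairing (V : (∀ i, ZMod (q i)) → ℂ) (n : ∀ i, ZMod (q i)) :
    ∑ l, dft q V l * pairing q l n = V n := by
  simp_rw [dft_eq, mul_assoc, Finset.sum_mul, mul_assoc, ← pairing_add_right]
  rw [← Finset.mul_sum, Finset.sum_comm]
  simp_rw [← Finset.mul_sum, sum_pairing, neg_add_eq_zero]
  simp [mul_comm, prod_natCast_ne_zero q]

lemma dft_neg_ofReal (V : (∀ i, ZMod (q i)) → ℝ) (l : ∀ i, ZMod (q i)) :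
    dft q (fun m => (V m : ℂ)) (-l) = (starRingEnd ℂ) (dft q (fun m => (V m : ℂ)) l) := by
  simp [dft_eq, pairing, AddChar.map_neg_eq_conj]

/-- The quasi-periodic weight `n ↦ ∏ j, z_j ^ n_j`, with representatives `0 ≤ n_j < q_j`. -/
def weight (z : Fin d → ℂ) (n : ∀ i, ZMod (q i)) : ℂ := ∏ j, z j ^ (n j).val

lemma val_add_one_eq_mod {N : ℕ} [NeZero N] (a : ZMod N) : (a + 1).val = (a.val + 1) % N := by
  conv_lhs => rw [← ZMod.natCast_zmod_val a]
  rw [← Nat.cast_one, ← Nat.cast_add, ZMod.val_natCast]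

lemma pow_val_add_one {N : ℕ} [NeZero N] (z : ℂ) (a : ZMod N) :
    (if a.val = N - 1 then z ^ N else 1) * z ^ (a + 1).val = z * z ^ a.val := by
  have hN : 0 < N := Nat.pos_of_ne_zero (NeZero.ne N)
  have hlt := a.val_lt
  rw [val_add_one_eq_mod]
  split_ifs with h
  · rw [h, Nat.sub_add_cancel hN, Nat.mod_self, ← pow_succ', Nat.sub_add_cancel hN]
    simp
  · rw [Nat.mod_eq_of_lt (by omega), pow_succ', one_mul]

lemma weight_add_single (z : Fin d → ℂ) (n : ∀ i, ZMod (q i)) (j : Fin d) :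
    (if (n j).val = q j - 1 then z j ^ q j else 1) * weight q z (n + Pi.single j 1)
      = z j * weight q z n := by
  rw [weight, weight, ← Finset.mul_prod_erase _ _ (Finset.mem_univ j),
    ← Finset.mul_prod_erase _ (fun i => z i ^ (n i).val) (Finset.mem_univ j), ← mul_assoc,
    ← mul_assoc]
  congr 1
  · simpa using pow_val_add_one (z j) (n j)
  · refine Finset.prod_congr rfl fun i hi => ?_
    simp [Pi.single_eq_of_ne (Finset.ne_of_mem_erase hi)]

lemma val_eq_pred_iff {N : ℕ} [NeZero N] (a : ZMod N) : a.val = N - 1 ↔ (a + 1).val = 0 := by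
  have hN : 0 < N := Nat.pos_of_ne_zero (NeZero.ne N)
  have hlt := a.val_lt
  rw [val_add_one_eq_mod]
  constructor
  · intro h
    rw [h, Nat.sub_add_cancel hN, Nat.mod_self]
  · intro h
    have := Nat.le_of_dvd (Nat.succ_pos _) (Nat.dvd_of_mod_eq_zero h)
    omega

lemma weight_sub_single (z : Fin d → ℂ) (hz : ∀ j, z j ≠ 0) (n : ∀ i, ZMod (q i)) (j : Fin d) :
    (if (n j).val = 0 then (z j ^ q j)⁻¹ else 1) * weight q z (n - Pi.single j 1)
      = (z j)⁻¹ * weight q z n := by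
  have h := weight_add_single q z (n - Pi.single j 1) j
  rw [sub_add_cancel] at h
  have h1 : ((n - Pi.single j 1 : ∀ i, ZMod (q i)) j).val = q j - 1 ↔ (n j).val = 0 := by
    rw [val_eq_pred_iff]
    simp
  simp only [h1] at h
  have hzj := hz j
  split_ifs at h ⊢ with hn
  · field_simp
    linear_combination -h
  · field_simp
    linear_combination -h

/-- The Floquet transform as a matrix: column `l` is the quasi-periodic plane wave. -/
def planeWave (z : Fin d → ℂ) : Matrix (∀ i, ZMod (q i)) (∀ i, ZMod (q i)) ℂ :=
  fun n l => pairing q l n * weight q z n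

lemma isUnit_planeWave {z : Fin d → ℂ} (hz : ∀ j, z j ≠ 0) : IsUnit (planeWave q z) := by
  let G : Matrix (∀ i, ZMod (q i)) (∀ i, ZMod (q i)) ℂ :=
    fun l n => (∏ i, (q i : ℂ))⁻¹ * pairing q l (-n) * (weight q z n)⁻¹
  refine IsUnit.of_mul_eq_one G ?_
  ext n n'
  have : ∀ l, planeWave q z n l * G l n' = (weight q z n * (weight q z n')⁻¹ *
      (∏ i, (q i : ℂ))⁻¹) * pairing q l (n + -n') := fun l => by
    rw [pairing_add_right]
    simp only [planeWave, G]
    ring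
  rw [Matrix.mul_apply]
  simp_rw [this]
  rw [← Finset.mul_sum, sum_pairing, Matrix.one_apply]
  simp only [← sub_eq_add_neg, sub_eq_zero]
  split_ifs with h
  · subst h
    have : weight q z n ≠ 0 := Finset.prod_ne_zero_iff.mpr fun j _ => pow_ne_zero _ (hz j)
    have := prod_natCast_ne_zero q
    field_simp
  · simp

lemma floquetMat_mul_planeWave (V : (∀ i, ZMod (q i)) → ℂ) {z : Fin d → ℂ} (hz : ∀ j, z j ≠ 0) :
    floquetMat q V (fun j => z j ^ q j) * planeWave q z
      = planeWave q z * (diagA q z + matB q V) := by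
  ext n l
  rw [Matrix.mul_add, Matrix.add_apply, diagA, Matrix.mul_diagonal, Matrix.mul_apply,
    Matrix.mul_apply]
  have hB : ∑ m, planeWave q z n m * matB q V m l = V n * planeWave q z n l := by
    rw [← Equiv.sum_comp (Equiv.addRight l), ← sum_dft_mul_pairing q V n, Finset.sum_mul]
    refine Finset.sum_congr rfl fun m _ => ?_
    simp only [planeWave, matB, Equiv.coe_addRight, add_sub_cancel_right, pairing_add_left]
    ring
  rw [hB]
  simp only [floquetMat, add_mul, Finset.sum_mul, Finset.sum_add_distrib, ite_mul, zero_mul]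
  simp only [Finset.sum_ite_eq', Finset.mem_univ, if_true]
  congr 1
  rw [mul_add, Finset.mul_sum, Finset.mul_sum]
  congr 1 <;> rw [Finset.sum_comm] <;> simp only [Finset.sum_ite_eq', Finset.mem_univ, if_true]
    <;> refine Finset.sum_congr rfl fun j _ => ?_
  · have := weight_add_single q z n j
    rw [planeWave, planeWave, pairing_add_right, pairing_single, rho_val]
    split_ifs at this ⊢ <;> linear_combination (pairing q l n * ZMod.stdAddChar (l j)) * this
  · have := weight_sub_single q z hz n j
    rw [planeWave, planeWave, sub_eq_add_neg, pairing_add_right, ← pairing_neg_left,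
      pairing_single, rho_val, Pi.neg_apply, AddChar.map_neg_eq_inv, mul_inv, ← sub_eq_add_neg]
    split_ifs at this ⊢ <;> linear_combination (pairing q l n * (ZMod.stdAddChar (l j))⁻¹) * this

/-- The Floquet matrix at `z_j ^ q_j` is similar to `A(z) + B_V`. -/
lemma charpoly_floquetMat (V : (∀ i, ZMod (q i)) → ℂ) {z : Fin d → ℂ} (hz : ∀ j, z j ≠ 0) :
    (floquetMat q V (fun j => z j ^ q j)).charpoly = (diagA q z + matB q V).charpoly := by
  obtain ⟨u, hu⟩ := isUnit_planeWave q hz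
  have h := floquetMat_mul_planeWave q V hz
  rw [← hu] at h
  rw [← Matrix.charpoly_units_conj u (diagA q z + matB q V), ← h, Matrix.mul_assoc,
    ← Matrix.coe_units_inv, Units.mul_inv, Matrix.mul_one]

end Fourier

section Reduction

open Polynomial

lemma infinite_unit_circle : {t : ℂ | ‖t‖ = 1}.Infinite := by
  have h : IsPreconnected (Metric.sphere (0 : ℂ) 1) :=
    isPreconnected_sphere (by rw [Complex.rank_real_complex]; norm_num) 0 1
  have hs : Metric.sphere (0 : ℂ) 1 = {t : ℂ | ‖t‖ = 1} := by
    ext t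
    simp
  rw [← hs]
  exact h.infinite_of_nontrivial ⟨1, by simp, -1, by simp, by norm_num⟩

/-- Matrices with the same characteristic polynomial have squares of the same trace. -/
lemma trace_mul_self_eq_of_charpoly_eq {n : Type*} [Fintype n] [DecidableEq n]
    {M N : Matrix n n ℂ} (h : M.charpoly = N.charpoly) : (M * M).trace = (N * N).trace := by
  have key : ∀ (K : Matrix n n ℂ) (x : ℂ), (K * K).charpoly.eval (x ^ 2)
      = (-1) ^ Fintype.card n * (K.charpoly.eval x * K.charpoly.eval (-x)) := fun K x => by
    have hK : Matrix.scalar n (x ^ 2) - K * K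
        = (Matrix.scalar n x - K) * -(Matrix.scalar n (-x) - K) := by
      rw [map_neg, pow_two, map_mul, neg_sub, sub_neg_eq_add, sub_mul, mul_add, mul_add,
        (Matrix.scalar_commute x (fun r => Commute.all x r) K).eq]
      abel
    rw [Matrix.eval_charpoly, Matrix.eval_charpoly, Matrix.eval_charpoly, hK, Matrix.det_mul,
      Matrix.det_neg]
    ring
  have hsq : (M * M).charpoly = (N * N).charpoly := Polynomial.funext fun y => by
    obtain ⟨x, rfl⟩ := IsAlgClosed.exists_pow_nat_eq y two_pos
    rw [key, key, h]
  rw [Matrix.trace_eq_neg_charpoly_nextCoeff, Matrix.trace_eq_neg_charpoly_nextCoeff, hsq]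

variable {d : ℕ} (q : Fin d → ℕ) [∀ i, NeZero (q i)] (S : Finset (Fin d))

/-- The frequencies whose coordinates in `S` all vanish. -/
def vanishingOn : AddSubgroup (∀ i, ZMod (q i)) where
  carrier := {n | ∀ i ∈ S, n i = 0}
  zero_mem' := fun _ _ => rfl
  add_mem' := fun {a b} ha hb i hi => by simp [ha i hi, hb i hi]
  neg_mem' := fun {a} ha i hi => by simp [ha i hi]

instance : DecidablePred (· ∈ vanishingOn q S) :=
  fun n => inferInstanceAs (Decidable (∀ i ∈ S, n i = 0))

/-- The difference of the symbols `∑ i ∈ S, ρ_{n_i}` at `0` and at `n`. -/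
def gap (n : ∀ i, ZMod (q i)) : ℂ := ∑ i ∈ S, (1 - ZMod.stdAddChar (n i))

/-- The free symbol in the coordinates outside `S`, at `z = 1`. -/
def freeSymbol (n : ∀ i, ZMod (q i)) : ℂ :=
  ∑ i ∈ Sᶜ, (ZMod.stdAddChar (n i) + (ZMod.stdAddChar (n i))⁻¹)

lemma gap_eq_zero {n : ∀ i, ZMod (q i)} (hn : n ∈ vanishingOn q S) : gap q S n = 0 :=
  Finset.sum_eq_zero fun i hi => by rw [hn i hi, AddChar.map_zero_eq_one, sub_self]

lemma gap_ne_zero {n : ∀ i, ZMod (q i)} (hn : n ∉ vanishingOn q S) : gap q S n ≠ 0 := by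
  have hn' : ∃ i ∈ S, n i ≠ 0 := by
    by_contra! h
    exact hn h
  obtain ⟨i, hi, hni⟩ := hn'
  have hnorm : ∀ i, ‖(ZMod.stdAddChar (n i) : ℂ)‖ = 1 := fun i => by
    rw [ZMod.stdAddChar_apply, Circle.norm_coe]
  have hre : 0 < (gap q S n).re := by
    rw [gap, Complex.re_sum]
    refine Finset.sum_pos' (fun j _ => ?_) ⟨i, hi, ?_⟩
    · have := Complex.re_le_norm (ZMod.stdAddChar (n j))
      rw [hnorm] at this
      simpa using this
    · have hle := Complex.re_le_norm (ZMod.stdAddChar (n i))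
      rw [hnorm] at hle
      have hne : (ZMod.stdAddChar (n i) : ℂ).re ≠ 1 := fun h => by
        have him : (ZMod.stdAddChar (n i) : ℂ).im = 0 := by
          have := Complex.sq_norm_sub_sq_re (ZMod.stdAddChar (n i))
          rw [hnorm, h] at this
          nlinarith
        apply hni
        apply ZMod.injective_stdAddChar
        rw [AddChar.map_zero_eq_one]
        exact Complex.ext (by simpa using h) (by simpa using him)
      have := lt_of_le_of_ne hle hne
      simpa using this
  intro h
  simp [h] at hre

/-- The matrix `x - A(z) - B_V` at `x = |S| / t + μ`, `z_i = 1 / t` on `S` and `z_i = 1` off `S`,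
with the rows outside `vanishingOn q S` multiplied by `t`; it is polynomial in `t = X`. -/
def pencil (V : (∀ i, ZMod (q i)) → ℂ) (μ : ℂ) :
    Matrix (∀ i, ZMod (q i)) (∀ i, ZMod (q i)) ℂ[X] :=
  Matrix.diagonal (fun n => C (gap q S n))
    + Matrix.diagonal (fun n => if n ∈ vanishingOn q S then 1 else X)
      * (Matrix.diagonal (fun n => C (μ - freeSymbol q S n)
          - C (∑ i ∈ S, (ZMod.stdAddChar (n i))⁻¹) * X) - (matB q V).map C)

lemma pencil_map_eval (V : (∀ i, ZMod (q i)) → ℂ) (μ t : ℂ) :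
    (pencil q S V μ).map (eval t) = Matrix.diagonal (gap q S)
      + Matrix.diagonal (fun n => if n ∈ vanishingOn q S then 1 else t)
        * (Matrix.diagonal (fun n => μ - freeSymbol q S n
            - (∑ i ∈ S, (ZMod.stdAddChar (n i))⁻¹) * t) - matB q V) := by
  ext n n'
  by_cases h : n = n'
  · subst h
    by_cases hn : n ∈ vanishingOn q S <;> simp [pencil, hn, Polynomial.eval_finsetSum]
  · by_cases hn : n ∈ vanishingOn q S <;> simp [pencil, hn, h, mul_comm t]

/-- The multipliers equal to `t⁻¹` on `S` and `1` elsewhere. -/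
def multiplier (t : ℂ) (i : Fin d) : ℂ := if i ∈ S then t⁻¹ else 1

lemma sub_diagA_multiplier (t μ : ℂ) (n : ∀ i, ZMod (q i)) :
    S.card * t⁻¹ + μ - ∑ j, (rho q j (n j).val * multiplier S t j
        + (rho q j (n j).val * multiplier S t j)⁻¹)
      = gap q S n * t⁻¹ + (μ - freeSymbol q S n
        - (∑ i ∈ S, (ZMod.stdAddChar (n i))⁻¹) * t) := by
  rw [← Finset.sum_add_sum_compl S]
  have h1 : ∑ j ∈ S, (rho q j (n j).val * multiplier S t j
        + (rho q j (n j).val * multiplier S t j)⁻¹)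
      = (∑ j ∈ S, ZMod.stdAddChar (n j)) * t⁻¹ + (∑ i ∈ S, (ZMod.stdAddChar (n i))⁻¹) * t := by
    rw [Finset.sum_mul, Finset.sum_mul, ← Finset.sum_add_distrib]
    refine Finset.sum_congr rfl fun j hj => ?_
    rw [multiplier, if_pos hj, rho_val, mul_inv, inv_inv]
  have h2 : ∑ j ∈ Sᶜ, (rho q j (n j).val * multiplier S t j
        + (rho q j (n j).val * multiplier S t j)⁻¹) = freeSymbol q S n := by
    refine Finset.sum_congr rfl fun j hj => ?_
    rw [multiplier, if_neg (Finset.mem_compl.mp hj), rho_val, mul_one]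
  have h3 : gap q S n = S.card - ∑ j ∈ S, ZMod.stdAddChar (n j) := by
    simp [gap, Finset.sum_sub_distrib]
  rw [h1, h2, h3]
  ring

lemma pencil_map_eval_of_ne_zero (V : (∀ i, ZMod (q i)) → ℂ) (μ : ℂ) {t : ℂ} (ht : t ≠ 0) :
    (pencil q S V μ).map (eval t)
      = Matrix.diagonal (fun n => if n ∈ vanishingOn q S then 1 else t)
        * (Matrix.scalar _ (S.card * t⁻¹ + μ) - (diagA q (multiplier S t) + matB q V)) := by
  rw [pencil_map_eval]
  ext n n'
  by_cases h : n = n'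
  · subst h
    have hA := sub_diagA_multiplier q S t μ n
    simp only [Matrix.add_apply, Matrix.diagonal_mul, Matrix.sub_apply, diagA,
      Matrix.diagonal_apply_eq, Matrix.scalar_apply, ← sub_sub, hA]
    split_ifs with hn
    · rw [gap_eq_zero q S hn]
      ring
    · field_simp
      ring
  · simp [h, diagA]

lemma det_pencil_eval (V : (∀ i, ZMod (q i)) → ℂ) (μ t : ℂ) :
    (pencil q S V μ).det.eval t = ((pencil q S V μ).map (eval t)).det :=
  (evalRingHom t).map_det (pencil q S V μ)

/-- Floquet isospectrality forces the determinants of the pencils to agree identically. -/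
lemma det_pencil_eq {V Y : (∀ i, ZMod (q i)) → ℂ} (hiso : FloquetIso q V Y) (μ : ℂ) :
    (pencil q S V μ).det = (pencil q S Y μ).det := by
  refine Polynomial.eq_of_infinite_eval_eq _ _ (infinite_unit_circle.mono fun t ht => ?_)
  have ht1 : ‖t‖ = 1 := ht
  have ht0 : t ≠ 0 := norm_ne_zero_iff.mp (by rw [ht1]; exact one_ne_zero)
  have hz : ∀ j, multiplier S t j ≠ 0 := fun j => by
    unfold multiplier
    split_ifs
    · exact inv_ne_zero ht0
    · exact one_ne_zero
  have hk : (fun j => multiplier S t j ^ q j) = fun j => Complex.exp (2 * Real.pi * Complex.I *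
      ((if j ∈ S then -(q j * (Complex.arg t / (2 * Real.pi))) else 0 : ℝ) : ℂ)) := by
    funext j
    unfold multiplier
    split_ifs
    · have hexp : t = Complex.exp (Complex.arg t * Complex.I) := by
        simpa [ht1] using (Complex.norm_mul_exp_arg_mul_I t).symm
      conv_lhs => rw [hexp]
      rw [← Complex.exp_neg, ← Complex.exp_nat_mul]
      congr 1
      have : (Real.pi : ℂ) ≠ 0 := by exact_mod_cast Real.pi_ne_zero
      push_cast
      field_simp
    · simp
  have hchar : (diagA q (multiplier S t) + matB q V).charpoly
      = (diagA q (multiplier S t) + matB q Y).charpoly := by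
    rw [← charpoly_floquetMat q V hz, ← charpoly_floquetMat q Y hz, hk]
    exact hiso _
  change eval t _ = eval t _
  rw [det_pencil_eval, det_pencil_eval, pencil_map_eval_of_ne_zero q S V μ ht0,
    pencil_map_eval_of_ne_zero q S Y μ ht0, Matrix.det_mul, Matrix.det_mul,
    ← Matrix.eval_charpoly, ← Matrix.eval_charpoly, hchar]

/-- The block of `B_V` on the frequencies vanishing on `S`. -/
def restrictedB (V : (∀ i, ZMod (q i)) → ℂ) : Matrix (vanishingOn q S) (vanishingOn q S) ℂ :=
  Matrix.of fun n n' => matB q V n n'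

/-- The Floquet matrix (in Fourier variables) of the potential averaged over the coordinates
in `S`. -/
def reducedMat (V : (∀ i, ZMod (q i)) → ℂ) :
    Matrix (vanishingOn q S) (vanishingOn q S) ℂ :=
  Matrix.diagonal (fun n : vanishingOn q S => freeSymbol q S n) + restrictedB q S V

lemma det_pencil_eval_zero (V : (∀ i, ZMod (q i)) → ℂ) (μ : ℂ) :
    (pencil q S V μ).det.eval 0 = (reducedMat q S V).charpoly.eval μ
      * ∏ n : {n // n ∉ vanishingOn q S}, gap q S n := by
  rw [det_pencil_eval, pencil_map_eval,
    Matrix.twoBlockTriangular_det _ (fun n => n ∈ vanishingOn q S), Matrix.eval_charpoly,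
    ← Matrix.det_diagonal]
  · congr 2
    · ext n n'
      by_cases h : n = n'
      · subst h
        simp [Matrix.toSquareBlockProp, reducedMat, restrictedB, gap_eq_zero q S n.2, sub_sub]
      · have h' : (n : ∀ i, ZMod (q i)) ≠ n' := fun e => h (Subtype.ext e)
        simp [Matrix.toSquareBlockProp, reducedMat, restrictedB, h, h']
    · ext n n'
      by_cases h : n = n'
      · subst h
        simp [Matrix.toSquareBlockProp, n.2]
      · have h' : (n : ∀ i, ZMod (q i)) ≠ n' := fun e => h (Subtype.ext e)
        simp [Matrix.toSquareBlockProp, n.2, h, h']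
  · intro n hn n' hn'
    have h : n ≠ n' := fun e => hn (e ▸ hn')
    simp [hn, h]

lemma charpoly_reducedMat_eq {V Y : (∀ i, ZMod (q i)) → ℂ} (hiso : FloquetIso q V Y) :
    (reducedMat q S V).charpoly = (reducedMat q S Y).charpoly := by
  refine Polynomial.funext fun μ => ?_
  have h := congrArg (eval 0) (det_pencil_eq q S hiso μ)
  rw [det_pencil_eval_zero, det_pencil_eval_zero] at h
  exact mul_right_cancel₀ (Finset.prod_ne_zero_iff.mpr fun n _ => gap_ne_zero q S n.2) h

lemma trace_reducedMat (V : (∀ i, ZMod (q i)) → ℂ) :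
    (reducedMat q S V).trace
      = ∑ n : vanishingOn q S, freeSymbol q S n + Fintype.card (vanishingOn q S) * dft q V 0 := by
  simp [reducedMat, restrictedB, Matrix.trace, matB, Finset.sum_add_distrib]

lemma trace_reducedMat_mul_self (V : (∀ i, ZMod (q i)) → ℂ) :
    (reducedMat q S V * reducedMat q S V).trace
      = ∑ n : vanishingOn q S, freeSymbol q S n ^ 2
        + 2 * (∑ n : vanishingOn q S, freeSymbol q S n) * dft q V 0
        + Fintype.card (vanishingOn q S)
          * ∑ l : vanishingOn q S, dft q V l * dft q V (-l) := by
  have hBB : (restrictedB q S V * restrictedB q S V).trace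
      = Fintype.card (vanishingOn q S)
          * ∑ l : vanishingOn q S, dft q V l * dft q V (-l) := by
    simp only [Matrix.trace, Matrix.diag_apply, Matrix.mul_apply, restrictedB, Matrix.of_apply, matB]
    have : ∀ n : vanishingOn q S, ∑ m : vanishingOn q S, dft q V (n - m) * dft q V (m - n)
        = ∑ l : vanishingOn q S, dft q V l * dft q V (-l) := fun n => by
      rw [← Equiv.sum_comp (Equiv.subLeft n) (fun l : vanishingOn q S =>
        dft q V l * dft q V (-l))]
      simp
    simp [this]
  rw [reducedMat, add_mul, mul_add, mul_add, Matrix.trace_add, Matrix.trace_add,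
    Matrix.trace_add, hBB, Matrix.diagonal_mul_diagonal, Matrix.trace_diagonal,
    Matrix.trace_mul_comm (restrictedB q S V) (Matrix.diagonal _)]
  have hD : (Matrix.diagonal (fun n : vanishingOn q S => freeSymbol q S n)
      * restrictedB q S V).trace
      = (∑ n : vanishingOn q S, freeSymbol q S n) * dft q V 0 := by
    simp [Matrix.trace, Matrix.diagonal_mul, restrictedB, matB, Finset.sum_mul]
  rw [hD]
  simp only [pow_two]
  ring

/-- For real Floquet isospectral potentials the `ℓ²`-mass of the Fourier transform on the
frequencies vanishing on `S` is the same. -/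
lemma sum_normSq_dft_eq (V Y : (∀ i, ZMod (q i)) → ℝ)
    (hiso : FloquetIso q (fun n => (V n : ℂ)) (fun n => (Y n : ℂ))) :
    ∑ l : vanishingOn q S, Complex.normSq (dft q (fun m => (V m : ℂ)) l)
      = ∑ l : vanishingOn q S, Complex.normSq (dft q (fun m => (Y m : ℂ)) l) := by
  have hchar := charpoly_reducedMat_eq q S hiso
  have hcard : (Fintype.card (vanishingOn q S) : ℂ) ≠ 0 :=
    Nat.cast_ne_zero.mpr Fintype.card_ne_zero
  have h1 : (reducedMat q S fun n => (V n : ℂ)).trace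
      = (reducedMat q S fun n => (Y n : ℂ)).trace := by
    rw [Matrix.trace_eq_neg_charpoly_nextCoeff, Matrix.trace_eq_neg_charpoly_nextCoeff, hchar]
  rw [trace_reducedMat, trace_reducedMat, add_right_inj] at h1
  have h2 := trace_mul_self_eq_of_charpoly_eq hchar
  rw [trace_reducedMat_mul_self, trace_reducedMat_mul_self, mul_left_cancel₀ hcard h1,
    add_right_inj] at h2
  have h3 := mul_left_cancel₀ hcard h2
  simp only [dft_neg_ofReal, Complex.mul_conj] at h3
  exact_mod_cast h3

end Reduction

/-- For real-valued Floquet isospectral potentials and every block `j`,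
the sums of `|V̂(l)|²` over `l` supported in the `j`-th block agree for `V` and `Y`. -/
theorem stmt10 {d r : ℕ} (hd : 1 ≤ d) (hr : 2 ≤ r)
    (q : Fin d → ℕ) [∀ i, NeZero (q i)]
    (ds : Fin r → ℕ) (hds : ∀ j, 1 ≤ ds j) (hsum : ∑ m, ds m = d)
    (V Y : (∀ i, ZMod (q i)) → ℝ)
    (hiso : FloquetIso q (fun n => (V n : ℂ)) (fun n => (Y n : ℂ))) :
    ∀ j : Fin r,
      ∑ l ∈ Finset.univ.filter (fun l : ∀ i, ZMod (q i) =>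
          ∀ i : Fin d, (i.val < blockOffset ds j ∨ blockOffset ds j + ds j ≤ i.val) → l i = 0),
        Complex.normSq (dft q (fun m => (V m : ℂ)) l)
      = ∑ l ∈ Finset.univ.filter (fun l : ∀ i, ZMod (q i) =>
          ∀ i : Fin d, (i.val < blockOffset ds j ∨ blockOffset ds j + ds j ≤ i.val) → l i = 0),
          Complex.normSq (dft q (fun m => (Y m : ℂ)) l) := by
  intro j
  let S : Finset (Fin d) := Finset.univ.filter fun i =>
    i.val < blockOffset ds j ∨ blockOffset ds j + ds j ≤ i.val
  have h := sum_normSq_dft_eq q S V Y hiso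
  have hmem : ∀ l : ∀ i, ZMod (q i), l ∈ Finset.univ.filter (fun l : ∀ i, ZMod (q i) =>
      ∀ i : Fin d, (i.val < blockOffset ds j ∨ blockOffset ds j + ds j ≤ i.val) → l i = 0)
      ↔ l ∈ vanishingOn q S := fun l => by
    simp [vanishingOn, S]
  rw [Finset.sum_subtype _ hmem, Finset.sum_subtype _ hmem]
  exact h

end DPSO
end
end

section
/- Assume d ≥ 3 and that the periods q₁,…,q_d are pairwise coprime. Let V, Y : W → ℝ be real-valued Γ-periodic potentials that are Fermi isospectral. If Y is (d₁,…,d_r) separable, then V is (d₁,…,d_r) separable. -/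
open scoped BigOperators

noncomputable section

namespace DPSO

lemma apply_eq_of_det_fromBlocks_eq_zero {m n : Type*} {_ : Fintype m} {_ : DecidableEq m}
    [Subsingleton m] [Fintype n] [DecidableEq n] (i : m) {A : Matrix m m ℂ} {B : Matrix m n ℂ}
    {C : Matrix n m ℂ} {D : Matrix n n ℂ} (hD : D.det ≠ 0)
    (h : (Matrix.fromBlocks A B C D).det = 0) : A i i = (B * D⁻¹ * C) i i := by
  have : Invertible D := Matrix.invertibleOfIsUnitDet _ (isUnit_iff_ne_zero.2 hD)
  rw [Matrix.det_fromBlocks₂₂, mul_eq_zero, or_iff_right hD,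
    Matrix.det_eq_elem_of_subsingleton _ i, Matrix.sub_apply, sub_eq_zero,
    Matrix.invOf_eq_nonsing_inv] at h
  exact h

open Filter Topology in
/-- Schur complement asymptotics: if a perturbed diagonal matrix is singular and all diagonal
entries but the one at `o` stay away from zero, the entry at `o` is determined to second order. -/
lemma tendsto_of_det_diagonal_add_smul_eq_zero {ι T : Type*} [Fintype ι] [DecidableEq ι]
    (o : ι) (C : Matrix ι ι ℂ) {F : Filter T} {ε : T → ℂ} {δ : T → ι → ℂ} {a : ι → ℂ}
    (hε : Tendsto ε F (𝓝 0)) (hε0 : ∀ᶠ t in F, ε t ≠ 0)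
    (hδ : ∀ n, Tendsto (fun t => δ t n) F (𝓝 (a n))) (ha : ∀ n, n ≠ o → a n ≠ 0)
    (hdet : ∀ᶠ t in F, (Matrix.diagonal (δ t) + ε t • C).det = 0) :
    Tendsto (fun t => δ t o / ε t ^ 2 + C o o / ε t) F
      (𝓝 (∑ n : {n // ¬ n = o}, C o n * C n o / a n)) := by
  classical
  let b : Matrix {n // n = o} {n // ¬ n = o} ℂ := C.toBlock _ _
  let c : Matrix {n // ¬ n = o} {n // n = o} ℂ := C.toBlock _ _
  let D : T → Matrix {n // ¬ n = o} {n // ¬ n = o} ℂ := fun t =>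
    Matrix.diagonal (fun n : {n // ¬ n = o} => δ t n) + ε t • C.toBlock _ _
  let D₀ : Matrix {n // ¬ n = o} {n // ¬ n = o} ℂ := Matrix.diagonal fun n => a n
  let i₀ : {n // n = o} := ⟨o, rfl⟩
  have hD₀ : D₀.det ≠ 0 := by
    rw [Matrix.det_diagonal]
    exact Finset.prod_ne_zero_iff.2 fun n _ => ha n n.2
  have hD : Tendsto D F (𝓝 D₀) := by
    have h1 : Tendsto (fun t => (fun n : {n // ¬ n = o} => δ t n)) F (𝓝 fun n => a n) :=
      tendsto_pi_nhds.2 fun n => hδ n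
    have h2 := ((continuous_id.matrix_diagonal).tendsto (fun n : {n // ¬ n = o} => a n)).comp h1
    have h3 := h2.add (hε.smul_const (C.toBlock (fun n => ¬ n = o) (fun n => ¬ n = o)))
    simpa [D, D₀, Function.comp_def] using h3
  have hDdet : ∀ᶠ t in F, (D t).det ≠ 0 :=
    ((continuous_id.matrix_det.tendsto D₀).comp hD).eventually_ne hD₀
  have hDinv : Tendsto (fun t => (D t)⁻¹) F (𝓝 D₀⁻¹) := by
    refine Tendsto.comp (continuousAt_matrix_inv D₀ ?_) hD
    simpa [Ring.inverse_eq_inv'] using continuousAt_inv₀ hD₀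
  have hlim : Tendsto (fun t => (b * (D t)⁻¹ * c) i₀ i₀) F (𝓝 ((b * D₀⁻¹ * c) i₀ i₀)) := by
    have hcont : Continuous fun M : Matrix {n // ¬ n = o} {n // ¬ n = o} ℂ =>
        (b * M * c) i₀ i₀ :=
      ((continuous_const.matrix_mul continuous_id).matrix_mul continuous_const).matrix_elem _ _
    exact (hcont.tendsto _).comp hDinv
  have hval : (b * D₀⁻¹ * c) i₀ i₀ = ∑ n : {n // ¬ n = o}, C o n * C n o / a n := by
    have hinv : D₀⁻¹ = Matrix.diagonal fun n : {n // ¬ n = o} => (a n)⁻¹ := by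
      refine Matrix.inv_eq_right_inv ?_
      rw [Matrix.diagonal_mul_diagonal, ← Matrix.diagonal_one]
      congr 1
      ext n
      exact mul_inv_cancel₀ (ha n n.2)
    rw [hinv, Matrix.mul_apply]
    refine Finset.sum_congr rfl fun n _ => ?_
    rw [Matrix.mul_diagonal]
    simp only [b, c, i₀, Matrix.toBlock_apply]
    ring
  rw [← hval]
  refine hlim.congr' ?_
  filter_upwards [hε0, hDdet, hdet] with t h0 hdt h
  rw [Matrix.det_toBlock _ (fun n => n = o)] at h
  have e1 : (Matrix.diagonal (δ t) + ε t • C).toBlock (fun n => n = o) (fun n => ¬ n = o)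
      = ε t • b := by
    ext ⟨i, hi⟩ ⟨j, hj⟩
    have : i ≠ j := fun h => hj (h ▸ hi)
    simp [b, this]
  have e2 : (Matrix.diagonal (δ t) + ε t • C).toBlock (fun n => ¬ n = o) (fun n => n = o)
      = ε t • c := by
    ext ⟨i, hi⟩ ⟨j, hj⟩
    have : i ≠ j := fun h => hi (h ▸ hj)
    simp [c, this]
  have e3 : (Matrix.diagonal (δ t) + ε t • C).toBlock (fun n => ¬ n = o) (fun n => ¬ n = o)
      = D t := by
    ext i j
    simp [D, Matrix.diagonal_apply, Subtype.ext_iff]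
  rw [e1, e2, e3] at h
  have h' := apply_eq_of_det_fromBlocks_eq_zero i₀ hdt h
  rw [Matrix.smul_mul, Matrix.smul_mul, Matrix.mul_smul, smul_smul, Matrix.smul_apply] at h'
  simp only [i₀, Matrix.toBlock_apply, Matrix.add_apply, Matrix.diagonal_apply_eq,
    Matrix.smul_apply, smul_eq_mul] at h'
  simp only [i₀]
  field_simp
  linear_combination -h'

open Filter Topology in
/-- Two singular perturbations of the same diagonal family agree to second order at `o`. -/
lemma sum_eq_of_det_diagonal_add_smul_eq_zero {ι T : Type*} [Fintype ι] [DecidableEq ι]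
    (o : ι) (C C' : Matrix ι ι ℂ) {F : Filter T} [F.NeBot] {ε : T → ℂ} {δ : T → ι → ℂ}
    {a : ι → ℂ} (hε : Tendsto ε F (𝓝 0)) (hε0 : ∀ᶠ t in F, ε t ≠ 0)
    (hδ : ∀ n, Tendsto (fun t => δ t n) F (𝓝 (a n))) (ha : ∀ n, n ≠ o → a n ≠ 0)
    (hdet : ∀ᶠ t in F, (Matrix.diagonal (δ t) + ε t • C).det = 0)
    (hdet' : ∀ᶠ t in F, (Matrix.diagonal (δ t) + ε t • C').det = 0) :
    ∑ n : {n // ¬ n = o}, C o n * C n o / a n = ∑ n : {n // ¬ n = o}, C' o n * C' n o / a n := by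
  have h := (tendsto_of_det_diagonal_add_smul_eq_zero o C hε hε0 hδ ha hdet).sub
    (tendsto_of_det_diagonal_add_smul_eq_zero o C' hε hε0 hδ ha hdet')
  have hoo : C o o - C' o o = 0 := by
    have h2 := hε.mul h
    rw [zero_mul] at h2
    refine tendsto_nhds_unique (tendsto_const_nhds.congr' ?_) h2
    filter_upwards [hε0] with t ht
    field_simp
    ring
  refine sub_eq_zero.1 (tendsto_nhds_unique h (tendsto_const_nhds.congr fun t => ?_))
  linear_combination (-1 / ε t) * hoo

open Filter Topology in
/-- A branch of zeros persists under perturbation of a parameter. -/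
lemma frequently_eq_zero_of_deriv_ne_zero {f : ℂ × ℂ → ℂ} {f' : ℂ} (hf : ContDiffAt ℂ 1 f 0)
    (h0 : f 0 = 0) (hderiv : HasDerivAt (fun s => f (0, s)) f' 0) (hf' : f' ≠ 0) :
    ∃ᶠ p in 𝓝 (0 : ℂ × ℂ), p.1 ≠ 0 ∧ f p = 0 := by
  have hs : HasStrictFDerivAt f (fderiv ℂ f 0) 0 := hf.hasStrictFDerivAt one_ne_zero
  have hF : HasStrictFDerivAt (fun p : ℂ × ℂ => (p.1, f p))
      ((ContinuousLinearMap.fst ℂ ℂ ℂ).prod (fderiv ℂ f 0)) 0 :=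
    hasStrictFDerivAt_fst.prodMk hs
  have hpart : fderiv ℂ f 0 (0, 1) = f' := by
    have hline : HasDerivAt (fun s : ℂ => ((0 : ℂ), s)) (0, 1) 0 :=
      (hasDerivAt_const _ _).prodMk (hasDerivAt_id _)
    exact (HasFDerivAt.comp_hasDerivAt (0 : ℂ) (by exact hs.hasFDerivAt) hline).unique hderiv
  have hmap := hF.map_nhds_eq_of_surj <| by
    rw [LinearMap.range_eq_top]
    rintro ⟨u, v⟩
    refine ⟨(u, (v - fderiv ℂ f 0 (u, 0)) / f'), Prod.ext rfl ?_⟩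
    have : (u, (v - fderiv ℂ f 0 (u, 0)) / f')
        = (u, (0 : ℂ)) + ((v - fderiv ℂ f 0 (u, 0)) / f') • ((0 : ℂ), (1 : ℂ)) := by simp
    change fderiv ℂ f 0 (u, (v - fderiv ℂ f 0 (u, 0)) / f') = v
    rw [this, map_add, map_smul, hpart, smul_eq_mul, div_mul_cancel₀ _ hf']
    ring
  have hfreq : ∃ᶠ y in 𝓝 ((0 : ℂ), (0 : ℂ)), y.1 ≠ 0 ∧ y.2 = 0 := by
    have ht : Tendsto (fun u : ℂ => (u, (0 : ℂ))) (𝓝[≠] 0) (𝓝 (0, 0)) :=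
      ((Continuous.prodMk_left (0 : ℂ)).tendsto 0).mono_left nhdsWithin_le_nhds
    exact ht.frequently (eventually_nhdsWithin_of_forall fun u hu => ⟨hu, rfl⟩).frequently
  rw [h0, Prod.fst_zero] at hmap
  rw [← hmap] at hfreq
  exact hfreq

/-- The characters of `∏ i, ZMod (q i)`. -/
def chr {d : ℕ} (q : Fin d → ℕ) [∀ i, NeZero (q i)] (l n : ∀ i, ZMod (q i)) : ℂ :=
  ∏ j, ZMod.stdAddChar (l j * n j)

/-- The Fourier coefficients of a potential with respect to the characters `chr`. -/
def fourierCoeff {d : ℕ} (q : Fin d → ℕ) [∀ i, NeZero (q i)] (V : (∀ i, ZMod (q i)) → ℂ)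
    (l : ∀ i, ZMod (q i)) : ℂ :=
  (∏ i, (q i : ℂ))⁻¹ * ∑ n, V n * chr q l (-n)

/-- The convolution matrix of a potential. -/
def convMat {d : ℕ} (q : Fin d → ℕ) [∀ i, NeZero (q i)] (V : (∀ i, ZMod (q i)) → ℂ) :
    Matrix (∀ i, ZMod (q i)) (∀ i, ZMod (q i)) ℂ :=
  fun l m => fourierCoeff q V (l - m)

/-- The Floquet–Bloch transform at the multiplier `z`. -/
def blochMat {d : ℕ} (q : Fin d → ℕ) [∀ i, NeZero (q i)] (z : Fin d → ℂ) :
    Matrix (∀ i, ZMod (q i)) (∀ i, ZMod (q i)) ℂ :=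
  fun n l => chr q l n * ∏ j, z j ^ (n j).val

lemma prod_pow_val_add_single {d : ℕ} (q : Fin d → ℕ) (z : Fin d → ℂ) (n : ∀ i, ZMod (q i))
    (j : Fin d) (a : ZMod (q j)) :
    ∏ i, z i ^ ((n + Pi.single j a : ∀ i, ZMod (q i)) i).val
      = z j ^ (n j + a).val * ∏ i ∈ Finset.univ.erase j, z i ^ (n i).val := by
  rw [← Finset.mul_prod_erase _ _ (Finset.mem_univ j)]
  congr 1
  · simp
  · refine Finset.prod_congr rfl fun i hi => ?_
    simp [Pi.single_eq_of_ne (Finset.ne_of_mem_erase hi)]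

section Fourier

variable {d : ℕ} (q : Fin d → ℕ) [∀ i, NeZero (q i)]

lemma prod_period_ne_zero : (∏ i, (q i : ℂ)) ≠ 0 :=
  Finset.prod_ne_zero_iff.2 fun i _ => Nat.cast_ne_zero.2 (NeZero.ne (q i))

lemma chr_comm (l n : ∀ i, ZMod (q i)) : chr q l n = chr q n l := by
  simp [chr, mul_comm]

lemma chr_add_right (l n m : ∀ i, ZMod (q i)) : chr q l (n + m) = chr q l n * chr q l m := by
  simp [chr, mul_add, AddChar.map_add_eq_mul, Finset.prod_mul_distrib]

lemma chr_add_left (l m n : ∀ i, ZMod (q i)) : chr q (l + m) n = chr q l n * chr q m n := by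
  rw [chr_comm, chr_add_right, chr_comm q n l, chr_comm q n m]

lemma chr_neg_left (l n : ∀ i, ZMod (q i)) : chr q (-l) n = chr q l (-n) := by
  simp [chr]

lemma chr_single (l : ∀ i, ZMod (q i)) (j : Fin d) (a : ZMod (q j)) :
    chr q l (Pi.single j a) = ZMod.stdAddChar (l j * a) := by
  rw [chr, Finset.prod_eq_single j]
  · simp
  · intro i _ hi
    simp [Pi.single_eq_of_ne hi]
  · simp

lemma conj_chr (l n : ∀ i, ZMod (q i)) : (starRingEnd ℂ) (chr q l n) = chr q l (-n) := by
  simp only [chr, map_prod, Pi.neg_apply, mul_neg]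
  refine Finset.prod_congr rfl fun j _ => ?_
  rw [← AddChar.map_neg_eq_conj]

lemma sum_chr (n : ∀ i, ZMod (q i)) :
    ∑ l, chr q l n = if n = 0 then ∏ i, (q i : ℂ) else 0 := by
  have h : ∑ l, chr q l n = ∏ j, ∑ x : ZMod (q j), ZMod.stdAddChar (x * n j) := by
    rw [Fintype.prod_sum]
    rfl
  rw [h]
  simp_rw [fun j => AddChar.sum_mulShift (n j) (ZMod.isPrimitive_stdAddChar (q j))]
  split_ifs with hn
  · subst hn
    simp [ZMod.card]
  · obtain ⟨j, hj⟩ := Function.ne_iff.1 hn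
    exact Finset.prod_eq_zero (Finset.mem_univ j) (if_neg hj ▸ Nat.cast_zero)

lemma sum_fourierCoeff_mul_chr (V : (∀ i, ZMod (q i)) → ℂ) (n : ∀ i, ZMod (q i)) :
    ∑ l, fourierCoeff q V l * chr q l n = V n := by
  have h : ∀ l, fourierCoeff q V l * chr q l n
      = ∑ m, (∏ i, (q i : ℂ))⁻¹ * V m * chr q l (-m + n) := fun l => by
    rw [fourierCoeff, Finset.mul_sum, Finset.sum_mul]
    refine Finset.sum_congr rfl fun m _ => ?_
    rw [chr_add_right]
    ring
  simp_rw [h]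
  rw [Finset.sum_comm]
  simp_rw [← Finset.mul_sum, sum_chr]
  rw [Finset.sum_eq_single n]
  · simp only [neg_add_cancel, if_true]
    field_simp [prod_period_ne_zero q]
  · intro m _ hm
    rw [if_neg fun h => hm (neg_add_eq_zero.1 h), mul_zero]
  · simp

lemma fourierCoeff_neg (V : (∀ i, ZMod (q i)) → ℝ) (l : ∀ i, ZMod (q i)) :
    fourierCoeff q (fun n => (V n : ℂ)) (-l)
      = (starRingEnd ℂ) (fourierCoeff q (fun n => (V n : ℂ)) l) := by
  simp only [fourierCoeff, map_mul, map_sum, map_inv₀, map_prod, map_natCast, Complex.conj_ofReal,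
    conj_chr, chr_neg_left]

lemma ite_mul_pow_val_add_one {N : ℕ} [NeZero N] (z : ℂ) (x : ZMod N) :
    (if x.val = N - 1 then z ^ N else 1) * z ^ (x + 1).val = z * z ^ x.val := by
  have hN := NeZero.pos N
  have hc : ((N - 1 : ℕ) : ZMod N) + 1 = 0 := by
    rw [← Nat.cast_add_one, Nat.sub_add_cancel hN, ZMod.natCast_self]
  have hx := ZMod.val_lt x
  split_ifs with h
  · have : x + 1 = 0 := by
      rw [← ZMod.natCast_zmod_val x, h, hc]
    rw [this, ZMod.val_zero, h, ← pow_succ', Nat.sub_add_cancel hN]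
    simp
  · have : (x + 1).val = x.val + 1 := by
      have h1 : x + 1 = ((x.val + 1 : ℕ) : ZMod N) := by simp
      rw [h1, ZMod.val_natCast, Nat.mod_eq_of_lt (by omega)]
    rw [this, pow_succ', one_mul]

lemma ite_mul_pow_val_sub_one {N : ℕ} [NeZero N] {z : ℂ} (hz : z ≠ 0) (x : ZMod N) :
    (if x.val = 0 then (z ^ N)⁻¹ else 1) * z ^ (x - 1).val = z⁻¹ * z ^ x.val := by
  have hN := NeZero.pos N
  have hc : ((N - 1 : ℕ) : ZMod N) + 1 = 0 := by
    rw [← Nat.cast_add_one, Nat.sub_add_cancel hN, ZMod.natCast_self]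
  have h := ite_mul_pow_val_add_one z (x - 1)
  rw [sub_add_cancel] at h
  have hx := ZMod.val_lt (x - 1)
  have hiff : (x - 1).val = N - 1 ↔ x.val = 0 := by
    constructor
    · intro h1
      rw [ZMod.val_eq_zero, ← sub_add_cancel x 1, ← ZMod.natCast_zmod_val (x - 1), h1, hc]
    · intro h1
      by_contra h2
      have h3 : (x - 1 + 1).val = (x - 1).val + 1 := by
        have h1 : x - 1 + 1 = (((x - 1).val + 1 : ℕ) : ZMod N) := by
          rw [Nat.cast_add, ZMod.natCast_zmod_val, Nat.cast_one]
        rw [h1, ZMod.val_natCast, Nat.mod_eq_of_lt (by omega)]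
      rw [sub_add_cancel] at h3
      omega
  simp only [hiff] at h
  split_ifs with h0
  · rw [if_pos h0] at h
    have := pow_ne_zero N hz
    field_simp
    linear_combination -h
  · rw [if_neg h0] at h
    field_simp
    linear_combination -h

lemma ite_mul_blochMat_add_single (z : Fin d → ℂ) (n l : ∀ i, ZMod (q i)) (j : Fin d) :
    (if (n j).val = q j - 1 then z j ^ q j else 1) * blochMat q z (n + Pi.single j 1) l
      = (ZMod.stdAddChar (l j) * z j) * blochMat q z n l := by
  have h := ite_mul_pow_val_add_one (z j) (n j)
  have h0 := prod_pow_val_add_single q z n j 0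
  simp only [Pi.single_zero, add_zero] at h0
  rw [blochMat, blochMat, chr_add_right, chr_single, mul_one, prod_pow_val_add_single, h0]
  linear_combination (chr q l n * ZMod.stdAddChar (l j) *
    ∏ i ∈ Finset.univ.erase j, z i ^ (n i).val) * h

lemma ite_mul_blochMat_sub_single {z : Fin d → ℂ} (hz : ∀ j, z j ≠ 0) (n l : ∀ i, ZMod (q i))
    (j : Fin d) :
    (if (n j).val = 0 then (z j ^ q j)⁻¹ else 1) * blochMat q z (n - Pi.single j 1) l
      = (ZMod.stdAddChar (l j) * z j)⁻¹ * blochMat q z n l := by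
  have h := ite_mul_pow_val_sub_one (hz j) (n j)
  have h0 := prod_pow_val_add_single q z n j 0
  simp only [Pi.single_zero, add_zero] at h0
  rw [sub_eq_add_neg, ← Pi.single_neg, blochMat, blochMat, chr_add_right, chr_single, mul_neg_one,
    prod_pow_val_add_single, h0, AddChar.map_neg_eq_inv, ← sub_eq_add_neg, mul_inv]
  linear_combination (chr q l n * (ZMod.stdAddChar (l j))⁻¹ *
    ∏ i ∈ Finset.univ.erase j, z i ^ (n i).val) * h

lemma floquetMat_mul_blochMat (V : (∀ i, ZMod (q i)) → ℂ) {z : Fin d → ℂ} (hz : ∀ j, z j ≠ 0) :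
    floquetMat q V (fun j => z j ^ q j) * blochMat q z
      = blochMat q z * (Matrix.diagonal (fun l => ∑ j, (ZMod.stdAddChar (l j) * z j
          + (ZMod.stdAddChar (l j) * z j)⁻¹)) + convMat q V) := by
  ext n l
  rw [Matrix.mul_add, Matrix.add_apply, Matrix.mul_diagonal, Matrix.mul_apply, Matrix.mul_apply]
  have hconv : ∑ m, blochMat q z n m * convMat q V m l = V n * blochMat q z n l := by
    rw [← Equiv.sum_comp (Equiv.addRight l)]
    simp only [Equiv.coe_addRight, convMat, add_sub_cancel_right]
    rw [← sum_fourierCoeff_mul_chr q V n, Finset.sum_mul]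
    refine Finset.sum_congr rfl fun m _ => ?_
    rw [blochMat, blochMat, chr_add_left]
    ring
  rw [hconv]
  simp only [floquetMat, add_mul, Finset.sum_mul, ite_mul, zero_mul, Finset.sum_add_distrib,
    Finset.mul_sum, mul_add]
  congr 1
  · congr 1 <;> rw [Finset.sum_comm] <;> refine Finset.sum_congr rfl fun j _ => ?_ <;>
      rw [Finset.sum_ite_eq', if_pos (Finset.mem_univ _), ← ite_mul, mul_comm (blochMat q z n l)]
    · exact ite_mul_blochMat_add_single q z n l j
    · exact ite_mul_blochMat_sub_single q hz n l j
  · simp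

lemma det_blochMat_ne_zero {z : Fin d → ℂ} (hz : ∀ j, z j ≠ 0) : (blochMat q z).det ≠ 0 := by
  have h : blochMat q z * Matrix.of (fun l n => chr q l (-n))
      = Matrix.diagonal fun n => (∏ i, (q i : ℂ)) * ∏ j, z j ^ (n j).val := by
    ext n m
    rw [Matrix.mul_apply]
    have : ∀ l, blochMat q z n l * Matrix.of (fun l n => chr q l (-n)) l m
        = (∏ j, z j ^ (n j).val) * chr q l (n - m) := fun l => by
      rw [blochMat, Matrix.of_apply, sub_eq_add_neg, chr_add_right]
      ring
    simp_rw [this]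
    rw [← Finset.mul_sum, sum_chr, Matrix.diagonal_apply]
    simp only [sub_eq_zero, mul_ite, mul_zero]
    split_ifs
    · ring
    · rfl
  intro h0
  have h1 := congrArg Matrix.det h
  rw [Matrix.det_mul, h0, zero_mul, Matrix.det_diagonal] at h1
  refine Finset.prod_ne_zero_iff.2 (fun n _ => ?_) h1.symm
  exact mul_ne_zero (prod_period_ne_zero q)
    (Finset.prod_ne_zero_iff.2 fun j _ => pow_ne_zero _ (hz j))

lemma det_floquetMat_sub_eq_zero_iff (V : (∀ i, ZMod (q i)) → ℂ) {z : Fin d → ℂ}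
    (hz : ∀ j, z j ≠ 0) (lam : ℂ) :
    (floquetMat q V (fun j => z j ^ q j) - lam • 1).det = 0
      ↔ (Matrix.diagonal (fun l : ∀ i, ZMod (q i) => ∑ j, (ZMod.stdAddChar (l j) * z j
          + (ZMod.stdAddChar (l j) * z j)⁻¹)) + (convMat q V - lam • 1)).det = 0 := by
  have h : (floquetMat q V (fun j => z j ^ q j) - lam • 1) * blochMat q z
      = blochMat q z * (Matrix.diagonal (fun l => ∑ j, (ZMod.stdAddChar (l j) * z j
          + (ZMod.stdAddChar (l j) * z j)⁻¹)) + (convMat q V - lam • 1)) := by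
    rw [sub_mul, floquetMat_mul_blochMat q V hz, ← add_sub_assoc, mul_sub, Matrix.smul_mul,
      Matrix.mul_smul, one_mul, mul_one]
  have h1 := congrArg Matrix.det h
  rw [Matrix.det_mul, Matrix.det_mul] at h1
  have h0 := det_blochMat_ne_zero q hz
  constructor <;> intro h2 <;> rw [h2] at h1 <;> simpa [h0] using h1

end Fourier

/-- The leading part of the symbol of the Laplacian at frequency `l`. -/
def symb {d : ℕ} (q : Fin d → ℕ) [∀ i, NeZero (q i)] (x : Fin d → ℂ) (l : ∀ i, ZMod (q i)) : ℂ :=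
  ∑ j, ZMod.stdAddChar (l j) * x j

/-- The symbol of the Laplacian at `ε⁻¹ x`, multiplied by `ε`. -/
def scaledSymb {d : ℕ} (q : Fin d → ℕ) [∀ i, NeZero (q i)] (ε : ℂ) (x : Fin d → ℂ)
    (l : ∀ i, ZMod (q i)) : ℂ :=
  ∑ j, (ZMod.stdAddChar (l j) * x j + ε ^ 2 * (ZMod.stdAddChar (l j) * x j)⁻¹)

section Asymptotics

variable {d : ℕ} (q : Fin d → ℕ) [∀ i, NeZero (q i)]

lemma stdAddChar_ne_zero {N : ℕ} [NeZero N] (a : ZMod N) : (ZMod.stdAddChar a : ℂ) ≠ 0 := by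
  simp [ZMod.stdAddChar_apply]

lemma det_scaledSymb_eq_zero_iff (V : (∀ i, ZMod (q i)) → ℂ) (lam : ℂ) {ε : ℂ} (hε : ε ≠ 0)
    {x : Fin d → ℂ} (hx : ∀ j, x j ≠ 0) :
    (Matrix.diagonal (scaledSymb q ε x) + ε • (convMat q V - lam • 1)).det = 0
      ↔ (floquetMat q V (fun j => (x j / ε) ^ q j) - lam • 1).det = 0 := by
  rw [det_floquetMat_sub_eq_zero_iff q V (z := fun j => x j / ε) (fun j => div_ne_zero (hx j) hε)]
  have h : Matrix.diagonal (scaledSymb q ε x) + ε • (convMat q V - lam • 1)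
      = ε • (Matrix.diagonal (fun l : ∀ i, ZMod (q i) => ∑ j, (ZMod.stdAddChar (l j) * (x j / ε)
          + (ZMod.stdAddChar (l j) * (x j / ε))⁻¹)) + (convMat q V - lam • 1)) := by
    rw [smul_add, ← Matrix.diagonal_smul]
    congr 2
    ext l
    simp only [scaledSymb, Pi.smul_apply, smul_eq_mul, Finset.mul_sum]
    refine Finset.sum_congr rfl fun j _ => ?_
    have := stdAddChar_ne_zero (l j)
    have := hx j
    field_simp
  rw [h, Matrix.det_smul, mul_eq_zero, or_iff_right (pow_ne_zero _ hε)]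

lemma symb_zero (x : Fin d → ℂ) : symb q x 0 = ∑ j, x j := by
  simp [symb]

lemma symb_add (x y : Fin d → ℂ) (l : ∀ i, ZMod (q i)) :
    symb q (x + y) l = symb q x l + symb q y l := by
  simp [symb, mul_add, Finset.sum_add_distrib]

lemma symb_smul (c : ℂ) (x : Fin d → ℂ) (l : ∀ i, ZMod (q i)) :
    symb q (c • x) l = c * symb q x l := by
  simp only [symb, Pi.smul_apply, smul_eq_mul, Finset.mul_sum]
  exact Finset.sum_congr rfl fun j _ => by ring

lemma scaledSymb_zero (x : Fin d → ℂ) : scaledSymb q 0 x = symb q x := by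
  ext l
  simp [scaledSymb, symb]

lemma contDiffAt_scaledSymb {w v : Fin d → ℂ} (hw : ∀ j, w j ≠ 0) (l : ∀ i, ZMod (q i)) :
    ContDiffAt ℂ 1 (fun p : ℂ × ℂ => scaledSymb q p.1 (w + p.2 • v) l) 0 := by
  refine ContDiffAt.sum fun j _ => ?_
  have h : ContDiffAt ℂ 1 (fun p : ℂ × ℂ => ZMod.stdAddChar (l j) * (w + p.2 • v) j) 0 := by
    simp only [Pi.add_apply, Pi.smul_apply, smul_eq_mul]
    fun_prop
  refine h.add ((contDiffAt_fst.pow 2).mul (h.inv ?_))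
  simpa using ⟨stdAddChar_ne_zero (l j), hw j⟩

lemma contDiffAt_det {ι E : Type*} [Fintype ι] [DecidableEq ι] [NormedAddCommGroup E]
    [NormedSpace ℂ E] {M : E → Matrix ι ι ℂ} {p : E}
    (hM : ∀ i j, ContDiffAt ℂ 1 (fun x => M x i j) p) : ContDiffAt ℂ 1 (fun x => (M x).det) p := by
  simp only [Matrix.det_apply, Units.smul_def, zsmul_eq_mul]
  exact ContDiffAt.sum fun σ _ => contDiffAt_const.mul (contDiffAt_prod fun i _ => hM _ _)

open Filter Topology in
/-- Fermi isospectral potentials have equal second order expansions of the branch of the Fermi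
surface asymptotic to the hyperplane `∑ j, x j = 0`. -/
lemma sum_fourierCoeff_div_symb_eq (V Y : (∀ i, ZMod (q i)) → ℂ) (hiso : FermiIso q V Y)
    {w : Fin d → ℂ} (hw : ∀ j, w j ≠ 0) (hsum : ∑ j, w j = 0) (hsymb : ∀ l, l ≠ 0 → symb q w l ≠ 0)
    (i : Fin d) :
    ∑ l : {l // ¬ l = (0 : ∀ i, ZMod (q i))},
        fourierCoeff q V (-l) * fourierCoeff q V l / symb q w l
      = ∑ l : {l // ¬ l = (0 : ∀ i, ZMod (q i))},
        fourierCoeff q Y (-l) * fourierCoeff q Y l / symb q w l := by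
  obtain ⟨lam, hlam⟩ := hiso
  let v : Fin d → ℂ := Pi.single i 1
  let f : ℂ × ℂ → ℂ := fun p =>
    (Matrix.diagonal (scaledSymb q p.1 (w + p.2 • v)) + p.1 • (convMat q V - lam • 1)).det
  have hf : ContDiffAt ℂ 1 f 0 := by
    refine contDiffAt_det fun l l' => ?_
    simp only [Matrix.add_apply, Matrix.smul_apply, smul_eq_mul]
    refine ContDiffAt.add ?_ (contDiffAt_fst.mul contDiffAt_const)
    by_cases h : l = l'
    · subst h
      simpa only [Matrix.diagonal_apply_eq] using contDiffAt_scaledSymb q hw l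
    · simpa only [Matrix.diagonal_apply_ne _ h] using contDiffAt_const
  have hline : ∀ s, f (0, s) = s * ∏ l ∈ Finset.univ.erase 0, (symb q w l + s * symb q v l) := by
    intro s
    simp only [f, scaledSymb_zero, zero_smul, add_zero, Matrix.det_diagonal]
    rw [← Finset.mul_prod_erase _ _ (Finset.mem_univ 0)]
    have h0 : symb q (w + s • v) 0 = s := by
      rw [symb_add, symb_smul, symb_zero, symb_zero, hsum]
      simp [v]
    rw [h0]
    simp only [symb_add, symb_smul]
  have hderiv : HasDerivAt (fun s => f (0, s)) (∏ l ∈ Finset.univ.erase 0, symb q w l) 0 := by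
    simp only [hline]
    have hg : DifferentiableAt ℂ
        (fun s : ℂ => ∏ l ∈ Finset.univ.erase 0, (symb q w l + s * symb q v l)) 0 := by
      fun_prop
    have := (hasDerivAt_id' (0 : ℂ)).fun_mul hg.hasDerivAt
    simpa using this
  have hfreq := frequently_eq_zero_of_deriv_ne_zero hf ((hline 0).trans (zero_mul _)) hderiv
    (Finset.prod_ne_zero_iff.2 fun l hl => hsymb l (Finset.ne_of_mem_erase hl))
  let F : Filter (ℂ × ℂ) := 𝓝 0 ⊓ 𝓟 {p | p.1 ≠ 0 ∧ f p = 0}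
  have : F.NeBot := frequently_mem_iff_neBot.1 hfreq
  have hmem : ∀ᶠ p in F, p.1 ≠ 0 ∧ f p = 0 := mem_inf_of_right (mem_principal_self _)
  have hne : ∀ᶠ p in F, ∀ j, (w + p.2 • v) j ≠ 0 := by
    refine eventually_all.2 fun j => Eventually.filter_mono inf_le_left ?_
    have hc : Continuous fun p : ℂ × ℂ => (w + p.2 • v) j := by
      simp only [Pi.add_apply, Pi.smul_apply, smul_eq_mul]
      fun_prop
    refine hc.continuousAt.eventually_ne ?_
    simpa using hw j
  have h := sum_eq_of_det_diagonal_add_smul_eq_zero (0 : ∀ i, ZMod (q i))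
    (convMat q V - lam • 1) (convMat q Y - lam • 1) (F := F) (ε := Prod.fst)
    (δ := fun p => scaledSymb q p.1 (w + p.2 • v)) (a := symb q w)
    ((continuous_fst.tendsto' (0 : ℂ × ℂ) 0 rfl).mono_left inf_le_left)
    (hmem.mono fun p hp => hp.1)
    (fun l => by
      have := (contDiffAt_scaledSymb q (v := v) hw l).continuousAt.tendsto
      simp only [Prod.fst_zero, Prod.snd_zero, zero_smul, add_zero, scaledSymb_zero] at this
      exact this.mono_left inf_le_left)
    hsymb (hmem.mono fun p hp => hp.2) ?_
  · have key : ∀ U : (∀ i, ZMod (q i)) → ℂ, ∀ l : {l // ¬ l = (0 : ∀ i, ZMod (q i))},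
        (convMat q U - lam • 1) 0 l = fourierCoeff q U (-l) ∧
        (convMat q U - lam • 1) l 0 = fourierCoeff q U l := fun U l => by
      constructor
      · simp [convMat, Matrix.one_apply_ne (Ne.symm l.2)]
      · simp [convMat, Matrix.one_apply_ne l.2]
    simpa only [(key _ _).1, (key _ _).2] using h
  · filter_upwards [hmem, hne] with p hp hx
    rw [det_scaledSymb_eq_zero_iff q Y lam hp.1 hx]
    have hV := (det_scaledSymb_eq_zero_iff q V lam hp.1 hx).1 hp.2
    have hz : (fun j => ((w + p.2 • v) j / p.1) ^ q j) ∈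
        {z : Fin d → ℂ | (∀ j, z j ≠ 0) ∧ (floquetMat q V z - lam • 1).det = 0} :=
      ⟨fun j => pow_ne_zero _ (div_ne_zero (hx j) hp.1), hV⟩
    rw [hlam] at hz
    exact hz.2

end Asymptotics

/-- A linear form vanishing on the common kernel of `∑ j, w j` and `∑ j, u j * w j` is a
combination of the two. -/
lemma exists_affine_of_forall_sum_eq_zero {d : ℕ} {f u : Fin d → ℂ} {i j : Fin d}
    (hij : u i ≠ u j)
    (h : ∀ w : Fin d → ℂ, ∑ k, w k = 0 → ∑ k, u k * w k = 0 → ∑ k, f k * w k = 0) :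
    ∃ α β : ℂ, ∀ k, f k = α + β * u k := by
  have hsub : u i - u j ≠ 0 := sub_ne_zero.2 hij
  have key : ∀ (g : Fin d → ℂ) (p : Fin d) (a b c : ℂ),
      ∑ k, g k * (Pi.single i a + Pi.single j b + Pi.single p c : Fin d → ℂ) k
        = g i * a + g j * b + g p * c := fun g p a b c => by
    simp [mul_add, Finset.sum_add_distrib, Pi.single_apply]
  refine ⟨f i - (f i - f j) / (u i - u j) * u i, (f i - f j) / (u i - u j), fun p => ?_⟩
  have hp := h (Pi.single i (u j - u p) + Pi.single j (u p - u i) + Pi.single p (u i - u j))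
    (by
      have := key (fun _ => 1) p (u j - u p) (u p - u i) (u i - u j)
      simp only [one_mul] at this
      rw [this]
      ring)
    (by
      rw [key]
      ring)
  rw [key] at hp
  field_simp
  linear_combination hp

/-- An affine map sending three points of the unit circle into the unit circle is either constant
or linear. -/
lemma eq_zero_or_eq_zero_of_norm_affine_eq_one {α β u₁ u₂ u₃ : ℂ}
    (h₁₂ : u₁ ≠ u₂) (h₁₃ : u₁ ≠ u₃) (h₂₃ : u₂ ≠ u₃)
    (hu₁ : ‖u₁‖ = 1) (hu₂ : ‖u₂‖ = 1) (hu₃ : ‖u₃‖ = 1)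
    (h₁ : ‖α + β * u₁‖ = 1) (h₂ : ‖α + β * u₂‖ = 1) (h₃ : ‖α + β * u₃‖ = 1) :
    α = 0 ∨ β = 0 := by
  let c := starRingEnd ℂ
  have quad : ∀ u : ℂ, ‖u‖ = 1 → ‖α + β * u‖ = 1 →
      β * c α * u ^ 2 + (α * c α + β * c β - 1) * u + α * c β = 0 := by
    intro u hu h
    have e1 : u * c u = 1 := by
      rw [Complex.mul_conj, Complex.normSq_eq_norm_sq, hu]
      simp
    have e2 : (α + β * u) * (c α + c β * c u) = 1 := by
      rw [← map_mul, ← map_add, Complex.mul_conj, Complex.normSq_eq_norm_sq, h]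
      simp
    linear_combination u * e2 - (α * c β + β * c β * u) * e1
  have q₁ := quad u₁ hu₁ h₁
  have q₂ := quad u₂ hu₂ h₂
  have q₃ := quad u₃ hu₃ h₃
  have h₁₂' := sub_ne_zero.2 h₁₂
  have h₁₃' := sub_ne_zero.2 h₁₃
  have h₂₃' := sub_ne_zero.2 h₂₃
  have h : (u₁ - u₂) * ((u₁ - u₃) * ((u₂ - u₃) * (β * c α))) = 0 := by
    linear_combination (u₂ - u₃) * q₁ - (u₁ - u₃) * q₂ + (u₁ - u₂) * q₃
  simp only [mul_eq_zero, h₁₂', h₁₃', h₂₃', false_or] at h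
  rcases h with h | h
  · exact Or.inr h
  · exact Or.inl ((map_eq_zero c).1 h)

lemma stdAddChar_pow_period {N : ℕ} [NeZero N] (a : ZMod N) :
    (ZMod.stdAddChar a : ℂ) ^ N = 1 := by
  rw [← AddChar.map_nsmul_eq_pow]
  simp

lemma norm_stdAddChar {N : ℕ} [NeZero N] (a : ZMod N) : ‖(ZMod.stdAddChar a : ℂ)‖ = 1 := by
  rw [ZMod.stdAddChar_apply, Circle.norm_coe]

lemma stdAddChar_eq_one_iff {N : ℕ} [NeZero N] (a : ZMod N) :
    (ZMod.stdAddChar a : ℂ) = 1 ↔ a = 0 := by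
  rw [← (ZMod.stdAddChar (N := N)).map_zero_eq_one, ZMod.injective_stdAddChar.eq_iff]

lemma eq_one_of_pow_eq_one_of_coprime {M N : ℕ} (h : Nat.Coprime M N) {β : ℂ} (hM : β ^ M = 1)
    (hN : β ^ N = 1) : β = 1 := by
  rw [← pow_one β, ← h.gcd_eq_one]
  exact pow_gcd_eq_one.2 ⟨hM, hN⟩

lemma stdAddChar_ne_of_coprime {M N : ℕ} [NeZero M] [NeZero N] (h : Nat.Coprime M N)
    {a : ZMod M} (ha : a ≠ 0) (b : ZMod N) :
    (ZMod.stdAddChar a : ℂ) ≠ ZMod.stdAddChar b := fun hab =>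
  ha <| (stdAddChar_eq_one_iff a).1 <| eq_one_of_pow_eq_one_of_coprime h (stdAddChar_pow_period a)
    (hab ▸ stdAddChar_pow_period b)

section Genericity

variable {d : ℕ} (q : Fin d → ℕ) [∀ i, NeZero (q i)]

lemma exists_generic (hd : 3 ≤ d) (hcop : ∀ i i' : Fin d, i ≠ i' → Nat.Coprime (q i) (q i'))
    {l : ∀ i, ZMod (q i)} {i i' : Fin d} (hii' : i ≠ i') (hi : l i ≠ 0) (hi' : l i' ≠ 0) :
    ∃ w : Fin d → ℂ, ∑ j, w j = 0 ∧ symb q w l = 0 ∧ (∀ j, w j ≠ 0) ∧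
      ∀ m, m ≠ 0 → m ≠ l → symb q w m ≠ 0 := by
  obtain ⟨k, hk⟩ : ∃ k, k ∉ ({i, i'} : Finset (Fin d)) := by
    by_contra! h
    have h1 := Finset.card_le_card (fun k _ => h k : Finset.univ ⊆ ({i, i'} : Finset (Fin d)))
    have h2 := Finset.card_le_two (a := i) (b := i')
    rw [Finset.card_univ, Fintype.card_fin] at h1
    omega
  simp only [Finset.mem_insert, Finset.mem_singleton, not_or] at hk
  obtain ⟨hki, hki'⟩ := hk
  let u : Fin d → ℂ := fun j => ZMod.stdAddChar (l j)
  have u12 : u i ≠ u i' := stdAddChar_ne_of_coprime (hcop _ _ hii') hi _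
  have u13 : u i ≠ u k := stdAddChar_ne_of_coprime (hcop _ _ (Ne.symm hki)) hi _
  have u23 : u i' ≠ u k := stdAddChar_ne_of_coprime (hcop _ _ (Ne.symm hki')) hi' _
  let φ : (Fin d → ℂ) → Module.Dual ℂ (Fin d → ℂ) := fun f => ∑ j, f j • LinearMap.proj j
  have φ_apply : ∀ f w, φ f w = ∑ j, f j * w j := fun f w => by simp [φ]
  let P : Submodule ℂ (Fin d → ℂ) := LinearMap.ker (φ 1) ⊓ LinearMap.ker (φ u)
  have memP : ∀ w, w ∈ P ↔ ∑ j, w j = 0 ∧ ∑ j, u j * w j = 0 := fun w => by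
    simp [P, φ_apply]
  have affine : ∀ f, (¬ ∃ w ∈ P, φ f w ≠ 0) → ∃ α β : ℂ, ∀ p, f p = α + β * u p := by
    intro f hf
    push Not at hf
    refine exists_affine_of_forall_sum_eq_zero u12 fun w h1 h2 => ?_
    rw [← φ_apply]
    exact hf w ((memP w).2 ⟨h1, h2⟩)
  let f : Fin d ⊕ {m // m ≠ 0 ∧ m ≠ l} → Fin d → ℂ :=
    Sum.elim (fun j => Pi.single j 1) (fun m j => ZMod.stdAddChar (m.1 j))
  obtain ⟨w, hwP, hw⟩ := Module.Dual.exists_forall_mem_ne_zero_of_forall_exists P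
    (fun t => φ (f t)) <| by
    rintro (j | ⟨m, hm0, hml⟩) <;> by_contra hcon <;> obtain ⟨α, β, h⟩ := affine _ hcon
    · simp only [f, Sum.elim_inl] at h
      have hβ : β = 0 := by
        have step : ∀ a b, a ≠ j → b ≠ j → u a ≠ u b → β = 0 := by
          intro a b ha hb hab
          have h1 := h a
          have h2 := h b
          rw [Pi.single_eq_of_ne ha] at h1
          rw [Pi.single_eq_of_ne hb] at h2
          have : β * (u a - u b) = 0 := by linear_combination h2 - h1
          exact (mul_eq_zero.1 this).resolve_right (sub_ne_zero.2 hab)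
        by_cases h1 : i = j
        · exact step i' k (h1 ▸ hii'.symm) (h1 ▸ hki) u23
        · by_cases h2 : i' = j
          · exact step i k h1 (h2 ▸ hki') u13
          · exact step i i' h1 h2 u12
      obtain ⟨b, hb⟩ : ∃ b, b ≠ j := by
        by_cases h1 : i = j
        · exact ⟨i', h1 ▸ hii'.symm⟩
        · exact ⟨i, h1⟩
      have h1 := h b
      have h2 := h j
      rw [Pi.single_eq_of_ne hb, hβ] at h1
      rw [Pi.single_eq_same, hβ] at h2
      exact one_ne_zero (α := ℂ) (by linear_combination h2 - h1)
    · simp only [f, Sum.elim_inr] at h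
      have hn : ∀ j, ‖α + β * u j‖ = 1 := fun j => by rw [← h j, norm_stdAddChar]
      rcases eq_zero_or_eq_zero_of_norm_affine_eq_one u12 u13 u23 (norm_stdAddChar _)
        (norm_stdAddChar _) (norm_stdAddChar _) (hn i) (hn i') (hn k) with hα | hβ
      · have hβ : ∀ j, β ^ q j = 1 := fun j => by
          have := congrArg (· ^ q j) (h j)
          simp only [hα, zero_add, mul_pow, u, stdAddChar_pow_period, mul_one] at this
          exact this.symm
        have hβ1 := eq_one_of_pow_eq_one_of_coprime (hcop _ _ hii') (hβ i) (hβ i')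
        refine hml (funext fun j => ZMod.injective_stdAddChar ?_)
        rw [h j, hα, hβ1, zero_add, one_mul]
      · have hα : ∀ j, α ^ q j = 1 := fun j => by
          have := congrArg (· ^ q j) (h j)
          simp only [hβ, zero_mul, add_zero, stdAddChar_pow_period] at this
          exact this.symm
        have hα1 := eq_one_of_pow_eq_one_of_coprime (hcop _ _ hii') (hα i) (hα i')
        refine hm0 (funext fun j => (stdAddChar_eq_one_iff _).1 ?_)
        rw [h j, hβ, hα1, zero_mul, add_zero]
  refine ⟨w, ((memP w).1 hwP).1, ((memP w).1 hwP).2, fun j => ?_, fun m hm0 hml => ?_⟩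
  · simpa [f, φ_apply, Pi.single_apply] using hw (Sum.inl j)
  · simpa [f, φ_apply, symb] using hw (Sum.inr ⟨m, hm0, hml⟩)

open Filter Topology in
/-- Linear independence of the functions `w ↦ (symb q w l)⁻¹` on the hyperplane `∑ j, w j = 0`,
for frequencies `l` with at least two nonzero coordinates. -/
lemma eq_zero_of_sum_div_symb_eq_zero (hd : 3 ≤ d)
    (hcop : ∀ i i' : Fin d, i ≠ i' → Nat.Coprime (q i) (q i')) (c : (∀ i, ZMod (q i)) → ℂ)
    (hc : ∀ w : Fin d → ℂ, (∀ j, w j ≠ 0) → ∑ j, w j = 0 → (∀ l, l ≠ 0 → symb q w l ≠ 0) →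
      ∑ l : {l // ¬ l = (0 : ∀ i, ZMod (q i))}, c l / symb q w l = 0)
    {l : ∀ i, ZMod (q i)} {i i' : Fin d} (hii' : i ≠ i') (hi : l i ≠ 0) (hi' : l i' ≠ 0) :
    c l = 0 := by
  obtain ⟨w, hw0, hwl, hwj, hwm⟩ := exists_generic q hd hcop hii' hi hi'
  let v : Fin d → ℂ := Pi.single i 1 - Pi.single i' 1
  have hv0 : ∑ j, v j = 0 := by simp [v]
  have hvl : symb q v l ≠ 0 := by
    have : symb q v l = ZMod.stdAddChar (l i) - ZMod.stdAddChar (l i') := by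
      simp [symb, v, mul_sub, Finset.sum_sub_distrib, Pi.single_apply]
    rw [this]
    exact sub_ne_zero.2 (stdAddChar_ne_of_coprime (hcop _ _ hii') hi _)
  have hsymb : ∀ (s : ℂ) m, symb q (w + s • v) m = symb q w m + s * symb q v m := fun s m => by
    rw [symb_add, symb_smul]
  have hl0 : l ≠ 0 := fun h => hi (by rw [h]; rfl)
  have hzero : ∀ᶠ s in 𝓝[≠] (0 : ℂ),
      ∑ m : {m // ¬ m = (0 : ∀ i, ZMod (q i))}, s * (c m / symb q (w + s • v) m) = 0 := by
    have h1 : ∀ᶠ s in 𝓝[≠] (0 : ℂ), ∀ j, (w + s • v) j ≠ 0 := by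
      refine eventually_all.2 fun j => Eventually.filter_mono nhdsWithin_le_nhds ?_
      have hcont : Continuous fun s : ℂ => (w + s • v) j := by
        simp only [Pi.add_apply, Pi.smul_apply, smul_eq_mul]
        fun_prop
      refine hcont.continuousAt.eventually_ne ?_
      simpa using hwj j
    have h2 : ∀ᶠ s in 𝓝[≠] (0 : ℂ), ∀ m, m ≠ 0 → symb q (w + s • v) m ≠ 0 := by
      refine eventually_all.2 fun m => ?_
      by_cases hm : m = 0
      · simp [hm]
      simp only [hsymb]
      by_cases hml : m = l
      · filter_upwards [self_mem_nhdsWithin] with s hs _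
        rw [hml, hwl, zero_add]
        exact mul_ne_zero hs hvl
      · have hcont : Continuous fun s : ℂ => symb q w m + s * symb q v m := by fun_prop
        have := hcont.continuousAt.eventually_ne (x := 0) (y := 0) (by simpa using hwm m hm hml)
        exact (this.filter_mono nhdsWithin_le_nhds).mono fun s hs _ => hs
    filter_upwards [h1, h2] with s hs1 hs2
    rw [← Finset.mul_sum, hc _ hs1 ?_ hs2, mul_zero]
    simp only [Pi.add_apply, Pi.smul_apply, Finset.sum_add_distrib, ← Finset.smul_sum, hw0, hv0]
    simp
  have hlim : Tendsto (fun s : ℂ => ∑ m : {m // ¬ m = (0 : ∀ i, ZMod (q i))},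
      s * (c m / symb q (w + s • v) m)) (𝓝[≠] 0)
      (𝓝 (∑ m : {m // ¬ m = (0 : ∀ i, ZMod (q i))},
        if m = ⟨l, hl0⟩ then c l / symb q v l else 0)) := by
    refine tendsto_finsetSum _ fun m _ => ?_
    simp only [hsymb]
    split_ifs with hm
    · subst hm
      refine tendsto_const_nhds.congr' ?_
      filter_upwards [self_mem_nhdsWithin] with s hs
      have hs : s ≠ 0 := hs
      simp only [hwl, zero_add]
      field_simp
    · have hml : m.1 ≠ l := fun h => hm (Subtype.ext h)
      have hcont : ContinuousAt (fun s : ℂ => s * (c m / (symb q w m + s * symb q v m))) 0 := by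
        have : symb q w m.1 + 0 * symb q v m.1 ≠ 0 := by simpa using hwm m.1 m.2 hml
        exact continuousAt_id.mul (continuousAt_const.div
          (continuousAt_const.add (continuousAt_id.mul continuousAt_const)) this)
      have := hcont.tendsto.mono_left (nhdsWithin_le_nhds (s := {0}ᶜ))
      simpa using this
  have h := tendsto_nhds_unique_of_eventuallyEq hlim tendsto_const_nhds hzero
  simpa [hvl] using h

end Genericity

/-- All nonzero coordinates of `l` lie in the `j`-th block. -/
def SupportedIn {d r : ℕ} (q : Fin d → ℕ) (ds : Fin r → ℕ) (hsum : ∑ m, ds m = d) (j : Fin r)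
    (l : ∀ i, ZMod (q i)) : Prop :=
  ∀ i, l i ≠ 0 → ∃ b, blockEmb ds hsum j b = i

lemma exists_blockEmb_eq {d r : ℕ} (ds : Fin r → ℕ) (hsum : ∑ m, ds m = d) (i : Fin d) :
    ∃ j b, blockEmb ds hsum j b = i := by
  subst hsum
  refine ⟨(finSigmaFinEquiv.symm i).1, (finSigmaFinEquiv.symm i).2, Fin.ext ?_⟩
  have h := finSigmaFinEquiv_apply (finSigmaFinEquiv.symm i)
  rw [Equiv.apply_symm_apply] at h
  rw [h]
  simp only [blockEmb, blockOffset, Nat.add_right_cancel_iff]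
  refine (Finset.sum_bij (fun k _ => Fin.castLE (finSigmaFinEquiv.symm i).1.2.le k) ?_ ?_ ?_
    ?_).symm
  · intro k _
    exact Finset.mem_filter.2 ⟨Finset.mem_univ _, Fin.lt_def.2 k.2⟩
  · intro k _ k' _ h
    simpa using h
  · intro m hm
    exact ⟨⟨m, Fin.lt_def.1 (Finset.mem_filter.1 hm).2⟩, Finset.mem_univ _, rfl⟩
  · intro k _
    rfl

section Separability

variable {d r : ℕ} (q : Fin d → ℕ) [∀ i, NeZero (q i)] (ds : Fin r → ℕ) (hsum : ∑ m, ds m = d)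

lemma fourierCoeff_eq_zero_of_isSeparable {Y : (∀ i, ZMod (q i)) → ℂ}
    (hY : IsSeparable q ds hsum Y) {l : ∀ i, ZMod (q i)}
    (hl : ∀ j, ¬ SupportedIn q ds hsum j l) : fourierCoeff q Y l = 0 := by
  obtain ⟨F, hF⟩ := hY
  simp_rw [fourierCoeff, hF, Finset.sum_mul]
  rw [Finset.sum_comm, Finset.sum_eq_zero, mul_zero]
  intro j _
  obtain ⟨i, hi, hb⟩ : ∃ i, l i ≠ 0 ∧ ∀ b, blockEmb ds hsum j b ≠ i := by
    simpa [SupportedIn] using hl j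
  set S := ∑ n : ∀ i, ZMod (q i), F j (fun b => n (blockEmb ds hsum j b)) * chr q l (-n) with hS
  have h : S = S * ZMod.stdAddChar (-(l i)) := by
    conv_lhs => rw [hS, ← Equiv.sum_comp (Equiv.addRight (Pi.single i 1 : ∀ i, ZMod (q i)))]
    rw [hS, Finset.sum_mul]
    refine Finset.sum_congr rfl fun n _ => ?_
    have h1 : (fun b => (n + Pi.single i 1 : ∀ i, ZMod (q i)) (blockEmb ds hsum j b))
        = fun b => n (blockEmb ds hsum j b) := by
      ext b
      simp [Pi.single_eq_of_ne (hb b)]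
    rw [Equiv.coe_addRight, h1, neg_add, chr_add_right, ← Pi.single_neg, chr_single, mul_neg_one,
      mul_assoc]
  have hne : (1 : ℂ) - ZMod.stdAddChar (-(l i)) ≠ 0 :=
    sub_ne_zero.2 fun h1 => hi (neg_eq_zero.1 ((stdAddChar_eq_one_iff _).1 h1.symm))
  have : S * (1 - ZMod.stdAddChar (-(l i))) = 0 := by linear_combination h
  exact (mul_eq_zero.1 this).resolve_right hne

lemma chr_eq_of_supportedIn {j : Fin r} {l : ∀ i, ZMod (q i)} (hl : SupportedIn q ds hsum j l)
    {n n' : ∀ i, ZMod (q i)}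
    (h : (fun b => n (blockEmb ds hsum j b)) = fun b => n' (blockEmb ds hsum j b)) :
    chr q l n = chr q l n' := by
  refine Finset.prod_congr rfl fun i _ => ?_
  by_cases hi : l i = 0
  · simp [hi]
  · obtain ⟨b, rfl⟩ := hl i hi
    rw [show n (blockEmb ds hsum j b) = n' (blockEmb ds hsum j b) from congrFun h b]

lemma isSeparable_of_fourierCoeff_eq_zero [NeZero r] {V : (∀ i, ZMod (q i)) → ℂ}
    (hV : ∀ l, (∀ j, ¬ SupportedIn q ds hsum j l) → fourierCoeff q V l = 0) :
    IsSeparable q ds hsum V := by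
  classical
  let block : (∀ i, ZMod (q i)) → Fin r := fun l =>
    if h : ∃ j, SupportedIn q ds hsum j l then h.choose else 0
  have hblock : ∀ l, fourierCoeff q V l ≠ 0 → SupportedIn q ds hsum (block l) l := by
    intro l hl
    have h : ∃ j, SupportedIn q ds hsum j l := by
      by_contra! h
      exact hl (hV l h)
    simp only [block, dif_pos h]
    exact h.choose_spec
  let G : Fin r → (∀ i, ZMod (q i)) → ℂ := fun j n =>
    ∑ l with block l = j, fourierCoeff q V l * chr q l n
  have hG : ∀ j n n', ((fun b => n (blockEmb ds hsum j b)) = fun b => n' (blockEmb ds hsum j b)) →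
      G j n = G j n' := by
    intro j n n' h
    refine Finset.sum_congr rfl fun l hl => ?_
    obtain rfl := (Finset.mem_filter.1 hl).2
    by_cases h0 : fourierCoeff q V l = 0
    · simp [h0]
    · rw [chr_eq_of_supportedIn q ds hsum (hblock l h0) h]
  refine ⟨fun j m => if h : ∃ n : ∀ i, ZMod (q i), (fun b => n (blockEmb ds hsum j b)) = m
    then G j h.choose else 0, fun n => ?_⟩
  have hn : ∀ j, ∃ n' : ∀ i, ZMod (q i),
      (fun b => n' (blockEmb ds hsum j b)) = fun b => n (blockEmb ds hsum j b) := fun j => ⟨n, rfl⟩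
  rw [← sum_fourierCoeff_mul_chr q V n, ← Finset.sum_fiberwise _ block]
  refine Finset.sum_congr rfl fun j _ => ?_
  beta_reduce
  rw [dif_pos (hn j)]
  exact (hG j _ _ (hn j).choose_spec).symm

end Separability

/-- For `d ≥ 3` and pairwise coprime periods, if real-valued `V, Y` are Fermi
isospectral and `Y` is `(d₁,…,d_r)` separable, then `V` is `(d₁,…,d_r)` separable. -/
theorem stmt11 {d r : ℕ} (hd : 3 ≤ d) (hr : 2 ≤ r)
    (q : Fin d → ℕ) [∀ i, NeZero (q i)]
    (hcop : ∀ i i' : Fin d, i ≠ i' → Nat.Coprime (q i) (q i'))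
    (ds : Fin r → ℕ) (hds : ∀ j, 1 ≤ ds j) (hsum : ∑ m, ds m = d)
    (V Y : (∀ i, ZMod (q i)) → ℝ)
    (hiso : FermiIso q (fun n => (V n : ℂ)) (fun n => (Y n : ℂ)))
    (hYsep : IsSeparable q ds hsum (fun n => (Y n : ℂ))) :
    IsSeparable q ds hsum (fun n => (V n : ℂ)) := by
  have : NeZero r := ⟨by omega⟩
  refine isSeparable_of_fourierCoeff_eq_zero q ds hsum fun l hl => ?_
  have hYl := fourierCoeff_eq_zero_of_isSeparable q ds hsum hYsep hl
  obtain ⟨i, hi⟩ : ∃ i, l i ≠ 0 := by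
    by_contra! h
    exact hl 0 fun i hi => absurd (h i) hi
  obtain ⟨i', hii', hi'⟩ : ∃ i', i ≠ i' ∧ l i' ≠ 0 := by
    by_contra! h
    obtain ⟨j, b, hb⟩ := exists_blockEmb_eq ds hsum i
    refine hl j fun i' hi' => ⟨b, hb.trans ?_⟩
    by_contra hne
    exact hi' (h i' hne)
  have hc := eq_zero_of_sum_div_symb_eq_zero q hd hcop
    (fun l => fourierCoeff q (fun n => (V n : ℂ)) (-l) * fourierCoeff q (fun n => (V n : ℂ)) l
      - fourierCoeff q (fun n => (Y n : ℂ)) (-l) * fourierCoeff q (fun n => (Y n : ℂ)) l)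
    (fun w hw h0 hs => by
      simp only [sub_div, Finset.sum_sub_distrib]
      exact sub_eq_zero.2 (sum_fourierCoeff_div_symb_eq q _ _ hiso hw h0 hs i))
    hii' hi hi'
  simpa [hYl, fourierCoeff_neg] using hc

end DPSO
end
end
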